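/- arXiv:1310.7608 — 2 statements merged into one kernel-verified Lean document; each statement's English description precedes it below -/
import Mathlib

section
/- Let K be a field of characteristic 0, or of characteristic p > n. Then every Sym(ℕ)-invariant ideal of the symmetric subalgebra R̄_n is finitely generated as a Sym(ℕ)-invariant ideal of R̄_n. -/
open MvPolynomial

/-- The action of a permutation `σ` of the column index set `ℕ` on the polynomial ring
`R_n = K[x_{ij} : 1 ≤ i ≤ n, j ∈ ℕ]`, given by `σ(x_{ij}) = x_{i σ(j)}`. -/
noncomputable def colPerm (K : Type*) [CommSemiring K] (n : ℕ) (σ : Equiv.Perm ℕ) :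
    MvPolynomial (Fin n × ℕ) K →ₐ[K] MvPolynomial (Fin n × ℕ) K :=
  rename (fun q => (q.1, σ q.2))

/-- The action of a permutation `τ ∈ S_n` of the row index set on
`R_n = K[x_{ij} : 1 ≤ i ≤ n, j ∈ ℕ]`, given by `τ(x_{ij}) = x_{τ(i) j}`. -/
noncomputable def rowPerm (K : Type*) [CommSemiring K] (n : ℕ) (τ : Equiv.Perm (Fin n)) :
    MvPolynomial (Fin n × ℕ) K →ₐ[K] MvPolynomial (Fin n × ℕ) K :=
  rename (fun q => (τ q.1, q.2))

/-- The subalgebra `R̄_n ⊆ R_n` of polynomials symmetric under all row permutations. -/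
noncomputable def symAlg (K : Type*) [CommSemiring K] (n : ℕ) :
    Subalgebra K (MvPolynomial (Fin n × ℕ) K) where
  carrier := {f | ∀ τ : Equiv.Perm (Fin n), rowPerm K n τ f = f}
  mul_mem' := fun {a b} ha hb => fun τ => by rw [map_mul, ha τ, hb τ]
  add_mem' := fun {a b} ha hb => fun τ => by rw [map_add, ha τ, hb τ]
  algebraMap_mem' := fun r => fun τ => by simp [rowPerm]

lemma rowPerm_colPerm (K : Type*) [CommSemiring K] (n : ℕ) (σ : Equiv.Perm ℕ)
    (τ : Equiv.Perm (Fin n)) (f : MvPolynomial (Fin n × ℕ) K) :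
    rowPerm K n τ (colPerm K n σ f) = colPerm K n σ (rowPerm K n τ f) := by
  simp only [rowPerm, colPerm, rename_rename]
  rfl

lemma colPerm_mem_symAlg (K : Type*) [CommSemiring K] (n : ℕ) (σ : Equiv.Perm ℕ)
    {f : MvPolynomial (Fin n × ℕ) K} (hf : f ∈ symAlg K n) :
    colPerm K n σ f ∈ symAlg K n := by
  intro τ
  rw [rowPerm_colPerm, hf τ]

/-- The action of `σ ∈ Sym(ℕ)` restricted to the symmetric subalgebra `R̄_n`. -/
noncomputable def colPermBar (K : Type*) [CommSemiring K] (n : ℕ) (σ : Equiv.Perm ℕ) :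
    symAlg K n →ₐ[K] symAlg K n :=
  ((colPerm K n σ).comp (symAlg K n).val).codRestrict (symAlg K n)
    (fun x => colPerm_mem_symAlg K n σ x.2)

/-- `h_k = Σ_{i=1}^n x_{i1} ⋯ x_{ik}` (with the first `k` columns indexed by `0,…,k-1`). -/
noncomputable def hPoly (K : Type*) [CommSemiring K] (n k : ℕ) : MvPolynomial (Fin n × ℕ) K :=
  ∑ i : Fin n, ∏ j ∈ Finset.range k, X (i, j)

lemma hPoly_mem_symAlg (K : Type*) [CommSemiring K] (n k : ℕ) : hPoly K n k ∈ symAlg K n := by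
  intro τ
  simp only [hPoly, rowPerm, map_sum, map_prod, rename_X]
  exact Equiv.sum_comp τ (fun i => ∏ j ∈ Finset.range k, (X (i, j) : MvPolynomial (Fin n × ℕ) K))

/-- `h_k` as an element of the symmetric subalgebra `R̄_n`. -/
noncomputable def hBar (K : Type*) [CommSemiring K] (n k : ℕ) : symAlg K n :=
  ⟨hPoly K n k, hPoly_mem_symAlg K n k⟩

open scoped MonomialOrder

section MonomialOrder

variable {ι : Type*} [LinearOrder ι]

/-- Renaming variables along a strictly monotone map preserves the lexicographic order. -/
theorem toLex_mapDomain_strictMono {e : ι → ι} (he : StrictMono e) :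
    StrictMono fun a : Lex (ι →₀ ℕ) => toLex (Finsupp.mapDomain e (ofLex a)) := by
  rintro a b ⟨i, hlt, hi⟩
  refine ⟨e i, fun j hj => ?_, ?_⟩
  · by_cases hjr : j ∈ Set.range e
    · obtain ⟨k, rfl⟩ := hjr
      simpa [Finsupp.mapDomain_apply he.injective] using hlt k (he.lt_iff_lt.1 hj)
    · simp [Finsupp.mapDomain_of_notMem_range _ _ hjr]
  · simpa [Finsupp.mapDomain_apply he.injective] using hi

theorem degree_lex_rename [WellFoundedGT ι] {R : Type*} [CommSemiring R] {e : ι → ι}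
    (he : StrictMono e) (f : MvPolynomial ι R) :
    MonomialOrder.lex.degree (rename e f) =
      (MonomialOrder.lex.degree f).mapDomain e := by
  classical
  rcases eq_or_ne f 0 with rfl | hf
  · simp
  apply MonomialOrder.lex.toSyn.injective
  apply le_antisymm
  · rw [MonomialOrder.degree_le_iff]
    intro c hc
    rw [support_rename_of_injective he.injective, Finset.mem_image] at hc
    obtain ⟨d, hd, rfl⟩ := hc
    exact (toLex_mapDomain_strictMono he).monotone (MonomialOrder.lex.le_degree hd)
  · apply MonomialOrder.le_degree
    rw [support_rename_of_injective he.injective]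
    exact Finset.mem_image_of_mem _ (MonomialOrder.degree_mem_support hf)

/-- Over a field, one may cancel the leading term of `f` against any nonzero `b` whose leading
monomial divides it. -/
theorem exists_sub_mul_eq_zero_or_degree_lt {σ K : Type*} [Field K] (m : MonomialOrder σ)
    {f b : MvPolynomial σ K} (hb : b ≠ 0) (hbf : m.degree b ≤ m.degree f) :
    ∃ q, f - q * b = 0 ∨ m.degree (f - q * b) ≺[m] m.degree f := by
  have hu : IsUnit (m.leadingCoeff b) := (m.leadingCoeff_ne_zero_iff.2 hb).isUnit
  by_cases hf : m.degree f = 0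
  · have hb0 : m.degree b = 0 := le_antisymm (hf ▸ hbf) bot_le
    obtain ⟨c, rfl⟩ : ∃ c, f = C c := ⟨_, m.degree_eq_zero_iff.1 hf⟩
    obtain ⟨d, rfl⟩ : ∃ d, b = C d := ⟨_, m.degree_eq_zero_iff.1 hb0⟩
    have hd : d ≠ 0 := by rintro rfl; simp at hb
    refine ⟨C (c * d⁻¹), Or.inl ?_⟩
    rw [← C_mul, mul_assoc, inv_mul_cancel₀ hd, mul_one, sub_self]
  · exact ⟨_, Or.inr (m.degree_reduce_lt hu hbf hf)⟩

end MonomialOrder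

/-- A partially well-ordered set lies above finitely many of its elements. -/
theorem Set.PartiallyWellOrderedOn.exists_finset_forall_exists {α : Type*} {r : α → α → Prop}
    {s : Set α} (hs : s.PartiallyWellOrderedOn r) :
    ∃ t : Finset α, ↑t ⊆ s ∧ ∀ x ∈ s, ∃ y ∈ t, r y x := by
  by_contra! h
  obtain ⟨f, hfs, hf⟩ := exists_seq_of_forall_finset_exists (· ∈ s) (fun y x => ¬ r y x) h
  obtain ⟨i, j, hij, hr⟩ := hs fun k => ⟨f k, hfs k⟩
  exact hf i j hij hr

section Columns

variable {n : ℕ}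

/-- The action on exponent vectors of a map of column indices. -/
abbrev colMap (n : ℕ) (e : ℕ → ℕ) (q : Fin n × ℕ) : Fin n × ℕ := (q.1, e q.2)

/-- Higman's lemma for monomials: up to shifting the columns by a strictly monotone map,
divisibility of monomials is a well-quasi-order. -/
theorem partiallyWellOrderedOn_exists_mapDomain_le (s : Set (Fin n × ℕ →₀ ℕ)) :
    s.PartiallyWellOrderedOn fun a b =>
      ∃ e : ℕ ↪o ℕ, Finsupp.mapDomain (colMap n e) a ≤ b := by
  intro f
  choose N hN using fun a : Fin n × ℕ →₀ ℕ => (a.support.image Prod.snd).bddAbove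
  have hN : ∀ (a : Fin n × ℕ →₀ ℕ) q, a q ≠ 0 → q.2 < N a + 1 := fun a q hq =>
    Nat.lt_succ_of_le (hN a (Finset.mem_image_of_mem _ (Finsupp.mem_support_iff.2 hq)))
  let L : (Fin n × ℕ →₀ ℕ) → List (Fin n → ℕ) := fun a =>
    (List.range (N a + 1)).map fun j i => a (i, j)
  have hpwo : (Set.univ : Set (Fin n → ℕ)).PartiallyWellOrderedOn (· ≤ ·) :=
    Set.isPWO_of_wellQuasiOrderedLE _
  obtain ⟨i, j, hij, h⟩ := hpwo.partiallyWellOrderedOn_sublistForall₂ (· ≤ ·)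
    (fun k => ⟨L (f k), fun x _ => Set.mem_univ x⟩)
  refine ⟨i, j, hij, ?_⟩
  obtain ⟨l, hl, hsub⟩ := List.sublistForall₂_iff.1 h
  obtain ⟨e, he⟩ := List.sublist_iff_exists_orderEmbedding_getElem?_eq.1 hsub
  refine ⟨e, fun q => ?_⟩
  have hinj : Function.Injective (colMap n e) := fun p q hpq => by
    simpa [colMap, Prod.ext_iff] using hpq
  by_cases hq : q ∈ Set.range (colMap n e)
  swap
  · simp [Finsupp.mapDomain_of_notMem_range _ _ hq]
  obtain ⟨⟨r, k⟩, rfl⟩ := hq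
  rw [Finsupp.mapDomain_apply hinj]
  rcases eq_or_ne ((f i).1 (r, k)) 0 with h0 | h0
  · simp [h0]
  have hk : k < (L (f i)).length := by simpa [L] using hN _ _ h0
  have hkl : k < l.length := hl.length_eq ▸ hk
  have h1 := hl.get hk hkl
  have h2 := he k
  rw [List.getElem?_eq_getElem hkl, eq_comm, List.getElem?_eq_some_iff] at h2
  obtain ⟨h3, h4⟩ := h2
  have h5 := h1 r
  simp only [List.get_eq_getElem, ← h4] at h5
  simpa [L] using h5

/-- A linear order on the variables in which later columns are smaller, so that it is
well-founded upwards. -/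
abbrev colLinearOrder (n : ℕ) : LinearOrder (Fin n × ℕ) :=
  LinearOrder.lift' (fun q => OrderDual.toDual (toLex (q.2, q.1))) fun p q h => by
    simpa [Prod.ext_iff, and_comm] using h

theorem wellFoundedGT_colLinearOrder (n : ℕ) :
    @WellFoundedGT (Fin n × ℕ) (colLinearOrder n).toLT :=
  @StrictAnti.wellFoundedGT _ _ (colLinearOrder n).toPreorder _
    (fun q : Fin n × ℕ => toLex (q.2, q.1)) inferInstance fun _ _ hpq => hpq

theorem exists_monomialOrder_degree_colMap (K : Type*) [CommSemiring K] (n : ℕ) :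
    ∃ m : MonomialOrder.{0, 0} (Fin n × ℕ), ∀ (e : ℕ ↪o ℕ) (f : MvPolynomial (Fin n × ℕ) K),
      m.degree (rename (colMap n e) f) = (m.degree f).mapDomain (colMap n e) := by
  refine ⟨@MonomialOrder.lex _ (colLinearOrder n) (wellFoundedGT_colLinearOrder n), fun e f =>
    @degree_lex_rename _ (colLinearOrder n) (wellFoundedGT_colLinearOrder n) _ _ _
      (fun p q hpq => ?_) f⟩
  change toLex (q.2, q.1) < toLex (p.2, p.1) at hpq
  change toLex (e q.2, q.1) < toLex (e p.2, p.1)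
  simpa [Prod.Lex.toLex_lt_toLex] using hpq

/-- On a given polynomial, a strictly monotone map of columns acts as some permutation. -/
theorem exists_colPerm_eq_rename {K : Type*} [CommSemiring K] (e : ℕ ↪o ℕ)
    (f : MvPolynomial (Fin n × ℕ) K) :
    ∃ σ : Equiv.Perm ℕ, colPerm K n σ f = rename (colMap n e) f := by
  classical
  obtain ⟨N, hN⟩ := (f.vars.image Prod.snd).bddAbove
  obtain ⟨σ, hσ⟩ := (Equiv.Perm.isMultiplyPretransitive ℕ (N + 1)).exists_smul_eq
    (Fin.valEmbedding) (Fin.valEmbedding.trans e.toEmbedding)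
  refine ⟨σ, hom_congr_vars (f₁ := (colPerm K n σ).toRingHom)
    (f₂ := (rename (colMap n e)).toRingHom) ?_ (fun q hq _ => ?_) rfl⟩
  · ext; simp [colPerm]
  have hq : q.2 < N + 1 := Nat.lt_succ_of_le (hN (Finset.mem_image_of_mem _ hq))
  have hqσ : σ q.2 = e q.2 := DFunLike.congr_fun hσ ⟨q.2, hq⟩
  simp [colPerm, colMap, hqσ]

variable {K : Type*} [Field K]

/-- The polynomial ring in `n × ℕ` variables is noetherian up to permutations of the columns. -/
theorem exists_finset_le_span_colPerm (J : Ideal (MvPolynomial (Fin n × ℕ) K))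
    (hJ : ∀ σ, ∀ f ∈ J, colPerm K n σ f ∈ J) :
    ∃ B : Finset (MvPolynomial (Fin n × ℕ) K), (B : Set (MvPolynomial (Fin n × ℕ) K)) ⊆ J ∧
      J ≤ Ideal.span {y | ∃ σ, ∃ b ∈ B, y = colPerm K n σ b} := by
  classical
  obtain ⟨m, hm⟩ := exists_monomialOrder_degree_colMap K n
  obtain ⟨t, hts, ht⟩ := (partiallyWellOrderedOn_exists_mapDomain_le
    (m.degree '' {f | f ∈ J ∧ f ≠ 0})).exists_finset_forall_exists
  obtain ⟨B, hBJ, rfl⟩ := Finset.subset_set_image_iff.1 hts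
  refine ⟨B, fun b hb => (hBJ hb).1, fun f hf => ?_⟩
  induction hd : m.toSyn (m.degree f) using WellFoundedLT.induction generalizing f with
  | ind d ih =>
  subst hd
  rcases eq_or_ne f 0 with rfl | hf0
  · exact zero_mem _
  obtain ⟨y, hy, e, he⟩ := ht _ ⟨f, ⟨hf, hf0⟩, rfl⟩
  obtain ⟨b, hb, rfl⟩ := Finset.mem_image.1 hy
  obtain ⟨σ, hσ⟩ := exists_colPerm_eq_rename e b
  rw [← hm, ← hσ] at he
  have hσ0 : colPerm K n σ b ≠ 0 := by
    have hinj : Function.Injective fun q : Fin n × ℕ => (q.1, σ q.2) := fun p q hpq => by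
      simpa [Prod.ext_iff] using hpq
    exact (map_ne_zero_iff _ (rename_injective _ hinj)).2 (hBJ hb).2
  obtain ⟨q, hq⟩ := exists_sub_mul_eq_zero_or_degree_lt m hσ0 he
  have hσB : q * colPerm K n σ b ∈ Ideal.span {y | ∃ σ, ∃ b ∈ B, y = colPerm K n σ b} :=
    Ideal.mul_mem_left _ _ (Ideal.subset_span ⟨σ, b, hb, rfl⟩)
  rw [← sub_add_cancel f (q * colPerm K n σ b)]
  refine add_mem ?_ hσB
  rcases hq with hq | hq
  · rw [hq]
    exact zero_mem _
  · exact ih _ hq _ (sub_mem hf (Ideal.mul_mem_left _ _ (hJ σ b (hBJ hb).1))) rfl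

/-- An ideal generated by a set stable under column permutations is generated by the orbits of
finitely many elements of that set. -/
theorem exists_finset_span_le_span_colPerm (S : Set (MvPolynomial (Fin n × ℕ) K))
    (hS : ∀ σ, ∀ f ∈ S, colPerm K n σ f ∈ S) :
    ∃ B : Finset (MvPolynomial (Fin n × ℕ) K), ↑B ⊆ S ∧
      Ideal.span S ≤ Ideal.span {y | ∃ σ, ∃ b ∈ B, y = colPerm K n σ b} := by
  classical
  obtain ⟨B, hB, hSB⟩ := exists_finset_le_span_colPerm (Ideal.span S) fun σ f hf => by
    have := Ideal.mem_map_of_mem (colPerm K n σ) hf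
    rw [Ideal.map_span] at this
    exact Ideal.span_mono (Set.image_subset_iff.2 (hS σ)) this
  choose! T hTS hT using fun b (hb : b ∈ B) => Submodule.mem_span_finite_of_mem_span (hB hb)
  refine ⟨B.biUnion T, by simpa using hTS, hSB.trans (Ideal.span_le.2 ?_)⟩
  rintro _ ⟨σ, b, hb, rfl⟩
  have := Ideal.mem_map_of_mem (colPerm K n σ) (hT b hb)
  rw [← Ideal.span, Ideal.map_span] at this
  refine Ideal.span_mono ?_ this
  rintro _ ⟨x, hx, rfl⟩
  exact ⟨σ, x, Finset.mem_biUnion.2 ⟨b, hb, hx⟩, rfl⟩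

/-- If `n!` is invertible in `K`, averaging over the row permutations shows that ideals of the
symmetric subalgebra are contracted from the polynomial ring. -/
theorem mem_span_of_coe_mem_span_image (hn : (n.factorial : K) ≠ 0) (X : Set (symAlg K n))
    {f : symAlg K n} (hf : (f : MvPolynomial (Fin n × ℕ) K) ∈ Ideal.span ((↑) '' X)) :
    f ∈ Ideal.span X := by
  have hsum (a : MvPolynomial (Fin n × ℕ) K) : ∑ τ, rowPerm K n τ a ∈ symAlg K n := fun τ => by
    rw [map_sum]
    refine Fintype.sum_equiv (Equiv.mulLeft τ) _ _ fun ρ => ?_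
    simp only [rowPerm, rename_rename]
    rfl
  have key : ∀ g ∈ Ideal.span ((↑) '' X : Set (MvPolynomial (Fin n × ℕ) K)), ∀ a,
      (⟨_, hsum (a * g)⟩ : symAlg K n) ∈ Ideal.span X := by
    intro g hg
    induction hg using Submodule.span_induction with
    | mem g hg =>
      obtain ⟨x, hx, rfl⟩ := hg
      intro a
      have : (⟨_, hsum (a * x)⟩ : symAlg K n) = ⟨_, hsum a⟩ * x := by
        ext1
        simp only [map_mul, x.2 _, Subalgebra.coe_mul, Finset.sum_mul]
      rw [this]
      exact Ideal.mul_mem_left _ _ (Ideal.subset_span hx)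
    | zero =>
      intro a
      convert zero_mem (Ideal.span X)
      ext1
      simp
    | add g h _ _ ihg ihh =>
      intro a
      convert add_mem (ihg a) (ihh a)
      simp [mul_add, Finset.sum_add_distrib]
    | smul b g _ ih =>
      intro a
      simpa only [smul_eq_mul, mul_assoc] using ih (a * b)
  have havg := Submodule.smul_of_tower_mem (Ideal.span X) (n.factorial : K)⁻¹ (key f hf 1)
  convert havg
  ext1
  have hrow : ∀ τ, rowPerm K n τ f = f := f.2
  simp [hrow, Fintype.card_perm, ← Nat.cast_smul_eq_nsmul K, smul_smul, hn]

end Columns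

/-- Krasilnikov, 1992. If `K` is a field of characteristic `0` or of
characteristic `p > n`, then every `Sym(ℕ)`-invariant ideal of the symmetric subalgebra
`R̄_n` is finitely generated as a `Sym(ℕ)`-invariant ideal. -/
theorem symInvariant_ideal_fg_of_large_char
    (K : Type) [Field K] (n : ℕ) (hn : 1 ≤ n) (p : ℕ) [CharP K p] (hp : p = 0 ∨ n < p)
    (I : Ideal (symAlg K n))
    (hI : ∀ σ : Equiv.Perm ℕ, Ideal.map (colPermBar K n σ) I = I) :
    ∃ B : Finset (symAlg K n), (↑B : Set (symAlg K n)) ⊆ I ∧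
      I = Ideal.span {y | ∃ σ : Equiv.Perm ℕ, ∃ b ∈ B, y = colPermBar K n σ b} := by
  classical
  have hfact : (n.factorial : K) ≠ 0 := by
    rw [Ne, CharP.cast_eq_zero_iff K p]
    rcases hp with rfl | hp
    · simpa using n.factorial_ne_zero
    · have hprime := (CharP.char_is_prime_or_zero K p).resolve_right (by omega)
      rw [hprime.dvd_factorial]
      omega
  have hmem : ∀ σ, ∀ f ∈ I, colPermBar K n σ f ∈ I := fun σ f hf =>
    hI σ ▸ Ideal.mem_map_of_mem (colPermBar K n σ) hf
  obtain ⟨T, hTI, hT⟩ := exists_finset_span_le_span_colPerm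
    ((↑) '' (I : Set (symAlg K n)) : Set (MvPolynomial (Fin n × ℕ) K)) (by
      rintro σ _ ⟨f, hf, rfl⟩
      exact ⟨_, hmem σ f hf, rfl⟩)
  obtain ⟨B, hBI, rfl⟩ := Finset.subset_set_image_iff.1 hTI
  refine ⟨B, hBI, le_antisymm (fun f hf => ?_) (Ideal.span_le.2 ?_)⟩
  · refine mem_span_of_coe_mem_span_image hfact _
      (Ideal.span_mono ?_ (hT (Ideal.subset_span ⟨f, hf, rfl⟩)))
    rintro _ ⟨σ, x, hx, rfl⟩
    obtain ⟨b, hb, rfl⟩ := Finset.mem_image.1 hx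
    exact ⟨colPermBar K n σ b, ⟨σ, b, hb, rfl⟩, rfl⟩
  · rintro _ ⟨σ, b, hb, rfl⟩
    exact hmem σ b (hBI hb)
end

section
/- Let K be a field of characteristic p > 0 and suppose n ≥ p. Let U be the smallest Sym(ℕ)-invariant ideal of R̄_n containing the set { h_k : k ∈ ℕ }. Then U is not finitely generated as a Sym(ℕ)-invariant ideal of R̄_n. -/
open MvPolynomial

/-- The orbit element `Σ_i ∏_{j ∈ S} x_{ij}` attached to a finite set `S` of columns. -/
noncomputable def hSet (K : Type*) [CommSemiring K] (n : ℕ) (S : Finset ℕ) :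
    MvPolynomial (Fin n × ℕ) K :=
  ∑ i : Fin n, ∏ j ∈ S, X (i, j)

lemma colPerm_hPoly (K : Type*) [CommSemiring K] (n k : ℕ) (σ : Equiv.Perm ℕ) :
    colPerm K n σ (hPoly K n k) = hSet K n ((Finset.range k).map σ.toEmbedding) := by
  simp [colPerm, hPoly, hSet]

/-- The specialization `x_{ij} ↦ t_j` for rows `i < p` and columns `j ≠ 0`, sending all other
variables to zero. -/
noncomputable def collapse (K : Type*) [CommSemiring K] (n p : ℕ) :
    MvPolynomial (Fin n × ℕ) K →ₐ[K] MvPolynomial ℕ K :=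
  aeval fun q => if q.1.val < p ∧ q.2 ≠ 0 then X q.2 else 0

lemma collapse_rowPerm_swap (K : Type*) [CommSemiring K] {n p : ℕ} {a b : Fin n}
    (ha : a.val < p) (hb : b.val < p) (f : MvPolynomial (Fin n × ℕ) K) :
    collapse K n p (rowPerm K n (Equiv.swap a b) f) = collapse K n p f := by
  rw [collapse, rowPerm, aeval_rename]
  congr 2
  funext q
  have : (Equiv.swap a b q.1).val < p ↔ q.1.val < p := by
    rw [Equiv.swap_apply_def]
    split_ifs with h₁ h₂
    · simp [h₁, ha, hb]
    · simp [h₂, ha, hb]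
    · rfl
  simp [this]

lemma collapse_pderiv_eq (K : Type*) [CommSemiring K] {n p : ℕ} {a b : Fin n}
    (ha : a.val < p) (hb : b.val < p) {f : MvPolynomial (Fin n × ℕ) K} (hf : f ∈ symAlg K n)
    (j : ℕ) :
    collapse K n p (pderiv (a, j) f) = collapse K n p (pderiv (b, j) f) := by
  have hinj : Function.Injective
      (fun q : Fin n × ℕ => (Equiv.swap a b q.1, q.2)) := by
    rintro ⟨x, y⟩ ⟨x', y'⟩ h
    simpa using h
  have h := pderiv_rename (R := K) hinj (b, j) f
  have hs : rename (fun q : Fin n × ℕ => (Equiv.swap a b q.1, q.2)) f = f :=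
    hf (Equiv.swap a b)
  rw [hs] at h
  simp only [Equiv.swap_apply_right] at h
  rw [h]
  exact collapse_rowPerm_swap K ha hb _

lemma pderiv_collapse (K : Type*) [CommSemiring K] (n p : ℕ) {j : ℕ} (hj : j ≠ 0)
    (f : MvPolynomial (Fin n × ℕ) K) :
    pderiv j (collapse K n p f) =
      ∑ i : Fin n with i.val < p, collapse K n p (pderiv (i, j) f) := by
  classical
  induction f using MvPolynomial.induction_on with
  | C a => simp
  | add f g hf hg => simp [hf, hg, Finset.sum_add_distrib]
  | mul_X f q hf =>
    have hX : pderiv j (collapse K n p (X q)) =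
        ∑ i : Fin n with i.val < p, collapse K n p (pderiv (i, j) (X q)) := by
      obtain ⟨a, l⟩ := q
      by_cases hl : l = j
      · subst hl
        by_cases ha : a.val < p
        · rw [Finset.sum_eq_single_of_mem a (by simpa using ha)]
          · simp [collapse, ha, hj]
          · intro b _ hb
            rw [pderiv_X_of_ne (by simpa using hb.symm), map_zero]
        · rw [Finset.sum_eq_zero]
          · simp [collapse, ha]
          · intro b hb
            have hab : a ≠ b := by
              rintro rfl
              exact ha (by simpa using hb)
            rw [pderiv_X_of_ne (by simpa using hab), map_zero]
      · rw [Finset.sum_eq_zero]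
        · simp only [collapse, aeval_X]
          split_ifs
          · exact pderiv_X_of_ne hl
          · exact map_zero _
        · intro b _
          rw [pderiv_X_of_ne (by simp [hl]), map_zero]
    simp only [map_mul, pderiv_mul, map_add, Finset.sum_add_distrib, hf, hX, Finset.sum_mul,
      Finset.mul_sum]

lemma card_filter_val_lt {n p : ℕ} (hpn : p ≤ n) :
    (Finset.univ.filter fun i : Fin n => i.val < p).card = p := by
  rw [Fin.card_filter_val_lt, min_eq_right hpn]

lemma pderiv_collapse_eq_zero (K : Type*) [CommSemiring K] {n p : ℕ} [CharP K p] (hp : 0 < p)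
    (hpn : p ≤ n) {j : ℕ} (hj : j ≠ 0) {f : MvPolynomial (Fin n × ℕ) K}
    (hf : f ∈ symAlg K n) :
    pderiv j (collapse K n p f) = 0 := by
  rw [pderiv_collapse K n p hj,
    Finset.sum_congr rfl fun i hi => collapse_pderiv_eq K (b := ⟨0, hp.trans_le hpn⟩)
      (by simpa using hi) hp hf j,
    Finset.sum_const, card_filter_val_lt hpn, nsmul_eq_mul, CharP.cast_eq_zero, zero_mul]

lemma collapse_hSet (K : Type*) [CommSemiring K] {n p : ℕ} [CharP K p] (hpn : p ≤ n)
    {S : Finset ℕ} (hS : S.Nonempty) :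
    collapse K n p (hSet K n S) = 0 := by
  have h : ∀ i : Fin n, collapse K n p (∏ j ∈ S, X (i, j)) =
      if i.val < p then ∏ j ∈ S, (if j ≠ 0 then X j else 0) else 0 := by
    intro i
    rw [map_prod]
    split_ifs with hi
    · simp [collapse, hi]
    · obtain ⟨j, hj⟩ := hS
      exact Finset.prod_eq_zero hj (by simp [collapse, hi])
  rw [hSet, map_sum, Finset.sum_congr rfl fun i _ => h i, ← Finset.sum_filter,
    Finset.sum_const, card_filter_val_lt hpn, nsmul_eq_mul, CharP.cast_eq_zero, zero_mul]

lemma pderiv_prod_X_of_notMem {K ι α : Type*} [CommSemiring K] (v : α) (S : Finset ι)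
    (f : ι → α) (h : ∀ j ∈ S, f j ≠ v) :
    pderiv v (∏ j ∈ S, X (f j) : MvPolynomial α K) = 0 := by
  classical
  induction S using Finset.induction_on with
  | empty => simp
  | insert a S ha ih =>
    rw [Finset.prod_insert ha, pderiv_mul, ih fun j hj => h j (Finset.mem_insert_of_mem hj),
      pderiv_X_of_ne (h a (Finset.mem_insert_self a S)), zero_mul, mul_zero, add_zero]

lemma collapse_pderiv_hSet (K : Type*) [CommSemiring K] {n p : ℕ} (hp : 0 < p) (hn : 0 < n)
    (S : Finset ℕ) :
    collapse K n p (pderiv ((⟨0, hn⟩ : Fin n), 0) (hSet K n S)) =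
      if 0 ∈ S then ∏ j ∈ S.erase 0, X j else 0 := by
  have h : pderiv ((⟨0, hn⟩ : Fin n), 0) (hSet K n S) =
      pderiv ((⟨0, hn⟩ : Fin n), 0) (∏ j ∈ S, X ((⟨0, hn⟩ : Fin n), j)) := by
    rw [hSet, map_sum]
    refine Finset.sum_eq_single_of_mem _ (Finset.mem_univ _) fun i _ hi => ?_
    exact pderiv_prod_X_of_notMem _ _ _ fun j _ hj => hi (congrArg Prod.fst hj)
  rw [h]
  split_ifs with h0
  · rw [← Finset.mul_prod_erase S _ h0, pderiv_mul, pderiv_X_self, one_mul,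
      pderiv_prod_X_of_notMem _ (S.erase 0) _ fun j hj hj' =>
        Finset.ne_of_mem_erase hj (congrArg Prod.snd hj'), mul_zero, add_zero, map_prod]
    refine Finset.prod_congr rfl fun j hj => ?_
    simp [collapse, hp, Finset.ne_of_mem_erase hj]
  · rw [pderiv_prod_X_of_notMem _ _ _ fun j hj hj' => ?_, map_zero]
    obtain rfl : j = 0 := congrArg Prod.snd hj'
    exact h0 hj

/-- The exponent vector of the squarefree monomial `∏_{j ∈ T} t_j`. -/
noncomputable def indicatorExp (T : Finset ℕ) : ℕ →₀ ℕ := ∑ j ∈ T, Finsupp.single j 1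

lemma indicatorExp_apply (T : Finset ℕ) (j : ℕ) :
    indicatorExp T j = if j ∈ T then 1 else 0 := by
  simp [indicatorExp, Finsupp.finsetSum_apply, Finsupp.single_apply]

lemma prod_X_eq_monomial (K : Type*) [CommSemiring K] (T : Finset ℕ) :
    (∏ j ∈ T, X j : MvPolynomial ℕ K) = monomial (indicatorExp T) 1 :=
  (monomial_sum_one T _).symm

lemma coeff_mul_prod_X_eq_zero {K : Type*} [CommSemiring K] {q : MvPolynomial ℕ K}
    {M T : Finset ℕ} (hq : ∀ j ∈ M, pderiv j q = 0) (h : T.card < M.card) :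
    coeff (indicatorExp M) (q * ∏ j ∈ T, X j) = 0 := by
  rw [prod_X_eq_monomial, coeff_mul_monomial']
  split_ifs with hle
  · obtain ⟨j, hjM, hjT⟩ := Finset.exists_mem_notMem_of_card_lt_card h
    have hj : (indicatorExp M - indicatorExp T) j = 1 := by
      simp [indicatorExp_apply, hjM, hjT]
    have hc := coeff_pderiv (i := j) q
      (indicatorExp M - indicatorExp T - Finsupp.single j 1)
    rw [hq j hjM, tsub_add_cancel_of_le (by simp [hj]),
      Finsupp.tsub_apply _ (Finsupp.single j 1), hj] at hc
    simpa using hc.symm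
  · rfl

lemma coeff_collapse_pderiv_mul_hSet (K : Type*) [CommSemiring K] {n p : ℕ} [CharP K p]
    (hp : 0 < p) (hpn : p ≤ n) {m : ℕ} {S : Finset ℕ} (hS : S.Nonempty) (hSm : S.card ≤ m)
    {g : MvPolynomial (Fin n × ℕ) K} (hg : g ∈ symAlg K n) :
    coeff (indicatorExp ((Finset.range (m + 1)).erase 0))
      (collapse K n p
        (pderiv ((⟨0, hp.trans_le hpn⟩ : Fin n), 0) (g * hSet K n S))) = 0 := by
  rw [pderiv_mul, map_add, map_mul, map_mul, collapse_hSet K hpn hS, mul_zero, zero_add,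
    collapse_pderiv_hSet K hp]
  split_ifs with h0
  · refine coeff_mul_prod_X_eq_zero (fun j hj =>
      pderiv_collapse_eq_zero K hp hpn (Finset.ne_of_mem_erase hj) hg) ?_
    rw [Finset.card_erase_of_mem h0, Finset.card_erase_of_mem (by simp), Finset.card_range]
    have := hS.card_pos
    omega
  · simp

/-- The `Sym(ℕ)`-invariant ideal of `R̄_n` generated by `h_1, …, h_m`. -/
noncomputable def truncIdeal (K : Type*) [CommSemiring K] (n m : ℕ) : Ideal (symAlg K n) :=
  Ideal.span {y | ∃ σ : Equiv.Perm ℕ, ∃ k, 1 ≤ k ∧ k ≤ m ∧ y = colPermBar K n σ (hBar K n k)}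

lemma truncIdeal_mono (K : Type*) [CommSemiring K] (n : ℕ) : Monotone (truncIdeal K n) := by
  intro a b hab
  refine Ideal.span_mono ?_
  rintro y ⟨σ, k, hk, hka, rfl⟩
  exact ⟨σ, k, hk, hka.trans hab, rfl⟩

lemma colPermBar_colPermBar (K : Type*) [CommSemiring K] (n : ℕ) (σ τ : Equiv.Perm ℕ)
    (f : symAlg K n) :
    colPermBar K n σ (colPermBar K n τ f) = colPermBar K n (σ * τ) f := by
  apply Subtype.ext
  change colPerm K n σ (colPerm K n τ f) = colPerm K n (σ * τ) f
  simp only [colPerm, rename_rename]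
  rfl

lemma colPermBar_mem_truncIdeal (K : Type*) [CommSemiring K] (n m : ℕ) (σ : Equiv.Perm ℕ)
    {f : symAlg K n} (hf : f ∈ truncIdeal K n m) :
    colPermBar K n σ f ∈ truncIdeal K n m := by
  suffices truncIdeal K n m ≤ (truncIdeal K n m).comap (colPermBar K n σ) from this hf
  refine Ideal.span_le.2 ?_
  rintro y ⟨τ, k, hk, hkm, rfl⟩
  refine Ideal.subset_span ⟨σ * τ, k, hk, hkm, ?_⟩
  exact colPermBar_colPermBar K n σ τ _

lemma exists_mem_truncIdeal (K : Type*) [CommSemiring K] (n : ℕ) {f : symAlg K n}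
    (hf : f ∈ Ideal.span
      {y | ∃ σ : Equiv.Perm ℕ, ∃ k, 1 ≤ k ∧ y = colPermBar K n σ (hBar K n k)}) :
    ∃ m, f ∈ truncIdeal K n m := by
  rw [← Submodule.mem_iSup_of_directed _ (truncIdeal_mono K n).directed_le]
  refine Ideal.span_le.2 ?_ hf
  rintro y ⟨σ, k, hk, rfl⟩
  exact Submodule.mem_iSup_of_mem k (Ideal.subset_span ⟨σ, k, hk, le_rfl, rfl⟩)

lemma hBar_succ_notMem_truncIdeal (K : Type*) [CommSemiring K] [Nontrivial K] {n p : ℕ}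
    [CharP K p] (hp : 0 < p) (hpn : p ≤ n) (m : ℕ) :
    hBar K n (m + 1) ∉ truncIdeal K n m := by
  intro hmem
  have key : ∀ f ∈ truncIdeal K n m, ∀ g : symAlg K n,
      coeff (indicatorExp ((Finset.range (m + 1)).erase 0)) (collapse K n p
        (pderiv ((⟨0, hp.trans_le hpn⟩ : Fin n), 0) ((g * f : symAlg K n) : _))) = 0 := by
    intro f hf
    refine Submodule.span_induction ?_ ?_ ?_ ?_ hf
    · rintro y ⟨σ, k, hk, hkm, rfl⟩ g
      have h : ((colPermBar K n σ (hBar K n k) : symAlg K n) : MvPolynomial (Fin n × ℕ) K) =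
          hSet K n ((Finset.range k).map σ.toEmbedding) := colPerm_hPoly K n k σ
      rw [MulMemClass.coe_mul, h]
      refine coeff_collapse_pderiv_mul_hSet K hp hpn ?_ (by simpa using hkm) g.2
      simpa using Nat.pos_iff_ne_zero.1 hk
    · simp
    · intro x y _ _ hx hy g
      rw [mul_add, AddMemClass.coe_add, map_add, map_add, coeff_add, hx g, hy g, add_zero]
    · intro a x _ hx g
      rw [smul_eq_mul, ← mul_assoc]
      exact hx (g * a)
  have h := key _ hmem 1
  rw [one_mul] at h
  change coeff _ (collapse K n p (pderiv _ (hSet K n (Finset.range (m + 1))))) = 0 at h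
  rw [collapse_pderiv_hSet K hp, if_pos (by simp), prod_X_eq_monomial, coeff_monomial,
    if_pos rfl] at h
  exact one_ne_zero h

/-- If `K` is a field of characteristic `p > 0` and `n ≥ p`, then the
smallest `Sym(ℕ)`-invariant ideal `U` of `R̄_n` containing `{h_k : k ∈ ℕ}` (i.e., the ideal
generated by the `Sym(ℕ)`-orbit of this set) is not finitely generated as a
`Sym(ℕ)`-invariant ideal of `R̄_n`. -/
theorem hIdeal_not_fg
    (K : Type) [Field K] (n p : ℕ) [CharP K p] (hp : 0 < p) (hpn : p ≤ n) :
    ¬ ∃ B : Finset (symAlg K n),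
        (↑B : Set (symAlg K n)) ⊆
          (Ideal.span {y | ∃ σ : Equiv.Perm ℕ, ∃ k, 1 ≤ k ∧ y = colPermBar K n σ (hBar K n k)} :
            Ideal (symAlg K n)) ∧
        Ideal.span {y | ∃ σ : Equiv.Perm ℕ, ∃ k, 1 ≤ k ∧ y = colPermBar K n σ (hBar K n k)} =
          Ideal.span {y | ∃ σ : Equiv.Perm ℕ, ∃ b ∈ B, y = colPermBar K n σ b} := by
  rintro ⟨B, hB, hspan⟩
  have hex : ∀ b : B, ∃ m, (b : symAlg K n) ∈ truncIdeal K n m := fun b =>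
    exists_mem_truncIdeal K n (hB b.2)
  choose deg hdeg using hex
  refine hBar_succ_notMem_truncIdeal K hp hpn (Finset.univ.sup deg) ?_
  have hle : Ideal.span {y | ∃ σ : Equiv.Perm ℕ, ∃ b ∈ B, y = colPermBar K n σ b} ≤
      truncIdeal K n (Finset.univ.sup deg) := by
    refine Ideal.span_le.2 ?_
    rintro y ⟨σ, b, hb, rfl⟩
    have hb_le : deg ⟨b, hb⟩ ≤ Finset.univ.sup deg :=
      Finset.le_sup (f := deg) (Finset.mem_univ _)
    exact colPermBar_mem_truncIdeal K n _ σ (truncIdeal_mono K n hb_le (hdeg ⟨b, hb⟩))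
  refine hle (hspan ▸ Ideal.subset_span ⟨1, Finset.univ.sup deg + 1, by omega, ?_⟩)
  apply Subtype.ext
  change hPoly K n _ = colPerm K n 1 (hPoly K n _)
  rw [colPerm_hPoly]
  simp [hPoly, hSet]
end
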